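/- arXiv:1610.06610 — 2 statements merged into one kernel-verified Lean document; each statement's English description precedes it below -/
import Mathlib

section
/- Let n ≥ 2 and let d, a be positive integers, set g = gcd(d,n), and assume a ≥ (n−g)(d−g)/g. Then the triple (n,d,a) is bad if and only if g does not divide a. -/
open MvPolynomial

/-- A sequence of polynomials is a regular sequence if each element is a
nonzerodivisor modulo the ideal generated by the previous ones. -/
def RegSeq {n : ℕ} (fs : List (MvPolynomial (Fin n) ℂ)) : Prop :=
  ∀ i : Fin fs.length, ∀ g : MvPolynomial (Fin n) ℂ,
    g * fs.get i ∈ Ideal.span {p | p ∈ fs.take i.1} →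
    g ∈ Ideal.span {p | p ∈ fs.take i.1}

/-- The sequence `x_1^d - x_n^d, …, x_{n-1}^d - x_n^d` in `ℂ[x_1,…,x_n]`. -/
noncomputable def powDiffSeq (n d : ℕ) : List (MvPolynomial (Fin n) ℂ) :=
  (List.finRange (n - 1)).map fun i =>
    X (⟨i.1, by have := i.isLt; omega⟩ : Fin n) ^ d -
    X (⟨n - 1, by have := i.isLt; omega⟩ : Fin n) ^ d

/-- The triple `(n,d,a)` is good if there is a homogeneous symmetric polynomial `f`
of degree `a` such that `x_1^d - x_n^d, …, x_{n-1}^d - x_n^d, f` is a regular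
sequence. -/
def GoodTriple (n d a : ℕ) : Prop :=
  ∃ f : MvPolynomial (Fin n) ℂ, f.IsHomogeneous a ∧ f.IsSymmetric ∧
    RegSeq (powDiffSeq n d ++ [f])

section PowDiff

variable {σ R : Type*} [CommRing R]

/-- The ideal generated by the differences `X j ^ d - X l ^ d` with `j ∈ S`. -/
noncomputable def powDiffIdeal (R : Type*) [CommRing R] (S : Set σ) (l : σ) (d : ℕ) :
    Ideal (MvPolynomial σ R) :=
  Ideal.span ((fun j => X j ^ d - X l ^ d) '' S)

lemma powDiffIdeal_mk_X_pow {S : Set σ} {l j : σ} (d : ℕ) (hj : j ∈ S) :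
    Ideal.Quotient.mk (powDiffIdeal R S l d) (X j) ^ d =
      Ideal.Quotient.mk (powDiffIdeal R S l d) (X l) ^ d := by
  rw [← map_pow, ← map_pow, Ideal.Quotient.eq]
  exact Ideal.subset_span ⟨j, hj, rfl⟩

variable [Fintype σ] [DecidableEq σ]

/-- The exponent of the normal form of a monomial under the rewriting
`X j ^ d ↦ X l ^ d` for `j ∈ S`. -/
noncomputable def foldExponent (S : Finset σ) (l : σ) (d : ℕ) (m : σ →₀ ℕ) : σ →₀ ℕ :=
  Finsupp.equivFunOnFinite.symm fun j =>
    if j ∈ S then m j % d else if j = l then m l + d * ∑ k ∈ S, m k / d else m j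

lemma foldExponent_apply (S : Finset σ) (l : σ) (d : ℕ) (m : σ →₀ ℕ) (j : σ) :
    foldExponent S l d m j =
      if j ∈ S then m j % d else if j = l then m l + d * ∑ k ∈ S, m k / d else m j := rfl

lemma foldExponent_add_single_of_notMem (S : Finset σ) (l : σ) (d : ℕ) (m : σ →₀ ℕ) {i : σ}
    (hi : i ∉ S) (k : ℕ) :
    foldExponent S l d (m + Finsupp.single i k) =
      foldExponent S l d m + Finsupp.single i k := by
  have hne : ∀ j ∈ S, i ≠ j := fun j hj h => hi (h ▸ hj)
  have hsum : ∑ j ∈ S, (m + Finsupp.single i k) j / d = ∑ j ∈ S, m j / d :=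
    Finset.sum_congr rfl fun j hj => by
      simp [Finsupp.single_eq_of_ne' (hne j hj)]
  ext j
  rw [Finsupp.add_apply, foldExponent_apply, foldExponent_apply, hsum]
  split_ifs with h1 h2
  · simp [Finsupp.single_eq_of_ne' (hne j h1)]
  · subst h2
    simp only [Finsupp.add_apply]
    ring
  · simp

lemma foldExponent_add_single_of_mem {S : Finset σ} {l : σ} (hl : l ∉ S) {d : ℕ} (hd : 0 < d)
    (m : σ →₀ ℕ) {i : σ} (hi : i ∈ S) :
    foldExponent S l d (m + Finsupp.single i d) =
      foldExponent S l d (m + Finsupp.single l d) := by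
  have hil : i ≠ l := fun h => hl (h ▸ hi)
  have hsum : ∑ j ∈ S, (m + Finsupp.single i d) j / d = ∑ j ∈ S, m j / d + 1 := by
    have : ∀ j ∈ S, (m + Finsupp.single i d) j / d = m j / d + if i = j then 1 else 0 := by
      intro j _
      rw [Finsupp.add_apply, Finsupp.single_apply]
      split_ifs
      · exact Nat.add_div_right _ hd
      · simp
    rw [Finset.sum_congr rfl this, Finset.sum_add_distrib]
    simp [hi]
  rw [foldExponent_add_single_of_notMem S l d m hl]
  ext j
  rw [Finsupp.add_apply, foldExponent_apply, foldExponent_apply, hsum]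
  split_ifs with h1 h2
  · have : l ≠ j := fun h => hl (h ▸ h1)
    rw [Finsupp.single_eq_of_ne' this, Finsupp.add_apply, Finsupp.single_apply]
    split_ifs <;> simp
  · subst h2
    simp [Finsupp.single_eq_of_ne' hil]
    ring
  · rw [Finsupp.add_apply, Finsupp.single_eq_of_ne' (Ne.symm h2),
      Finsupp.single_eq_of_ne' (fun h : i = j => h1 (h ▸ hi))]

/-- The normal form of a polynomial modulo `powDiffIdeal`. -/
noncomputable def foldPoly (R : Type*) [CommRing R] (S : Finset σ) (l : σ) (d : ℕ) :
    MvPolynomial σ R →ₗ[R] MvPolynomial σ R :=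
  (basisMonomials σ R).constr R fun m => monomial (foldExponent S l d m) 1

lemma foldPoly_monomial (S : Finset σ) (l : σ) (d : ℕ) (m : σ →₀ ℕ) :
    foldPoly R S l d (monomial m 1) = monomial (foldExponent S l d m) 1 := by
  have := (basisMonomials σ R).constr_basis R
    (fun m => monomial (foldExponent S l d m) (1 : R)) m
  rwa [coe_basisMonomials] at this

lemma foldPoly_mul_X_pow (S : Finset σ) (l : σ) (d : ℕ) {i : σ} (hi : i ∉ S) (k : ℕ)
    (p : MvPolynomial σ R) :
    foldPoly R S l d (p * X i ^ k) = foldPoly R S l d p * X i ^ k := by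
  have : (foldPoly R S l d).comp (LinearMap.mulRight R (X i ^ k)) =
      (LinearMap.mulRight R (X i ^ k)).comp (foldPoly R S l d) := by
    refine (basisMonomials σ R).ext fun m => ?_
    simp [coe_basisMonomials, X_pow_eq_monomial, foldPoly_monomial, monomial_mul,
      foldExponent_add_single_of_notMem S l d m hi]
  exact LinearMap.congr_fun this p

lemma foldPoly_mul_X_pow_of_mem {S : Finset σ} {l : σ} (hl : l ∉ S) {d : ℕ} (hd : 0 < d)
    {i : σ} (hi : i ∈ S) (p : MvPolynomial σ R) :
    foldPoly R S l d (p * X i ^ d) = foldPoly R S l d (p * X l ^ d) := by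
  have : (foldPoly R S l d).comp (LinearMap.mulRight R (X i ^ d)) =
      (foldPoly R S l d).comp (LinearMap.mulRight R (X l ^ d)) := by
    refine (basisMonomials σ R).ext fun m => ?_
    simp [coe_basisMonomials, X_pow_eq_monomial, foldPoly_monomial, monomial_mul,
      foldExponent_add_single_of_mem hl hd m hi]
  exact LinearMap.congr_fun this p

lemma foldPoly_eq_zero_of_mem {S : Finset σ} {l : σ} (hl : l ∉ S) {d : ℕ} (hd : 0 < d)
    {p : MvPolynomial σ R} (hp : p ∈ powDiffIdeal R (S : Set σ) l d) :
    foldPoly R S l d p = 0 := by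
  refine Submodule.span_induction (p := fun p _ => ∀ q, foldPoly R S l d (q * p) = 0)
    ?_ ?_ ?_ ?_ hp 1 |> fun h => by simpa using h
  · rintro _ ⟨i, hi, rfl⟩ q
    rw [mul_sub, map_sub, foldPoly_mul_X_pow_of_mem hl hd hi, sub_self]
  · simp
  · intro x y _ _ hx hy q
    rw [mul_add, map_add, hx, hy, add_zero]
  · intro a x _ hx q
    rw [smul_eq_mul, ← mul_assoc, hx]

lemma foldExponent_eq_self {S : Finset σ} {l : σ} {d : ℕ} {m : σ →₀ ℕ}
    (h : ∀ j ∈ S, m j < d) : foldExponent S l d m = m := by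
  ext j
  have hsum : ∑ k ∈ S, m k / d = 0 :=
    Finset.sum_eq_zero fun k hk => Nat.div_eq_of_lt (h k hk)
  rw [foldExponent_apply, hsum]
  split_ifs with h1 h2
  · exact Nat.mod_eq_of_lt (h j h1)
  · simp [h2]
  · rfl

lemma mk_monomial_foldExponent {S : Finset σ} {l : σ} (hl : l ∉ S) {d : ℕ} (hd : 0 < d)
    (m : σ →₀ ℕ) :
    Ideal.Quotient.mk (powDiffIdeal R (S : Set σ) l d) (monomial (foldExponent S l d m) 1) =
      Ideal.Quotient.mk (powDiffIdeal R (S : Set σ) l d) (monomial m 1) := by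
  induction hk : ∑ j ∈ S, m j using Nat.strong_induction_on generalizing m with
  | _ k ih =>
  subst hk
  by_cases h : ∀ j ∈ S, m j < d
  · rw [foldExponent_eq_self h]
  · push Not at h
    obtain ⟨i, hi, hdi⟩ := h
    obtain ⟨m, rfl⟩ : ∃ m', m = m' + Finsupp.single i d :=
      ⟨m - Finsupp.single i d, (tsub_add_cancel_of_le (Finsupp.single_le_iff.2 hdi)).symm⟩
    rw [foldExponent_add_single_of_mem hl hd m hi, ih _ ?_ (m + Finsupp.single l d) rfl]
    · have (j : σ) : (monomial (m + Finsupp.single j d) 1 : MvPolynomial σ R) =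
          monomial m 1 * X j ^ d := by
        rw [X_pow_eq_monomial, monomial_mul, one_mul]
      rw [this, this, map_mul, map_mul, map_pow, map_pow, powDiffIdeal_mk_X_pow d hi]
    · have hil : ∀ j ∈ S, Finsupp.single l d j = 0 := fun j hj =>
        Finsupp.single_eq_of_ne' fun h => hl (h ▸ hj)
      simp only [Finsupp.add_apply, Finset.sum_add_distrib, Finset.sum_eq_zero hil]
      simpa [Finsupp.single_apply, hi] using hd

lemma mk_foldPoly {S : Finset σ} {l : σ} (hl : l ∉ S) {d : ℕ} (hd : 0 < d)
    (p : MvPolynomial σ R) :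
    Ideal.Quotient.mk (powDiffIdeal R (S : Set σ) l d) (foldPoly R S l d p) =
      Ideal.Quotient.mk (powDiffIdeal R (S : Set σ) l d) p := by
  have : (Ideal.Quotient.mkₐ R (powDiffIdeal R (S : Set σ) l d)).toLinearMap.comp
        (foldPoly R S l d) =
      (Ideal.Quotient.mkₐ R (powDiffIdeal R (S : Set σ) l d)).toLinearMap := by
    refine (basisMonomials σ R).ext fun m => ?_
    simpa [coe_basisMonomials, foldPoly_monomial] using mk_monomial_foldExponent hl hd m
  exact LinearMap.congr_fun this p

lemma mem_powDiffIdeal_iff {S : Finset σ} {l : σ} (hl : l ∉ S) {d : ℕ} (hd : 0 < d)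
    {p : MvPolynomial σ R} :
    p ∈ powDiffIdeal R (S : Set σ) l d ↔ foldPoly R S l d p = 0 := by
  refine ⟨foldPoly_eq_zero_of_mem hl hd, fun h => ?_⟩
  rw [← Ideal.Quotient.eq_zero_iff_mem, ← mk_foldPoly hl hd, h, map_zero]

variable [IsDomain R]

lemma mem_powDiffIdeal_of_mul_X {S : Finset σ} {l : σ} (hl : l ∉ S) {d : ℕ} (hd : 0 < d)
    {p : MvPolynomial σ R} (hp : p * X l ∈ powDiffIdeal R (S : Set σ) l d) :
    p ∈ powDiffIdeal R (S : Set σ) l d := by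
  rw [mem_powDiffIdeal_iff hl hd] at hp ⊢
  rw [← pow_one (X l), foldPoly_mul_X_pow S l d hl] at hp
  exact (mul_eq_zero.1 hp).resolve_right (pow_ne_zero _ (X_ne_zero l))

lemma mem_powDiffIdeal_of_mul_sub {S : Finset σ} {l i : σ} (hl : l ∉ S) (hi : i ∉ S)
    (hil : i ≠ l) {d : ℕ} (hd : 0 < d) {p : MvPolynomial σ R}
    (hp : p * (X i ^ d - X l ^ d) ∈ powDiffIdeal R (S : Set σ) l d) :
    p ∈ powDiffIdeal R (S : Set σ) l d := by
  rw [mem_powDiffIdeal_iff hl hd] at hp ⊢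
  rw [mul_sub, map_sub, foldPoly_mul_X_pow S l d hl, foldPoly_mul_X_pow S l d hi,
    ← mul_sub] at hp
  refine (mul_eq_zero.1 hp).resolve_right fun h => hil ?_
  rw [sub_eq_zero, X_pow_eq_monomial, X_pow_eq_monomial] at h
  have := monomial_left_injective (one_ne_zero (α := R)) h
  exact Finsupp.single_left_injective hd.ne' this

end PowDiff

lemma aeval_mul_left_of_isHomogeneous {σ R A : Type*} [CommSemiring R]
    [CommSemiring A] [Algebra R A] {f : MvPolynomial σ R} {a : ℕ} (hf : f.IsHomogeneous a)
    (b : A) (c : σ → A) : aeval (fun i => b * c i) f = b ^ a * aeval c f := by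
  rw [aeval_def, aeval_def, eval₂_eq, eval₂_eq, Finset.mul_sum]
  refine Finset.sum_congr rfl fun m hm => ?_
  rw [hf.degree_eq_sum_deg_support hm, Finset.prod_congr rfl fun i _ => mul_pow b (c i) (m i),
    Finset.prod_mul_distrib, Finset.prod_pow_eq_pow_sum]
  ring

/-- A homogeneous polynomial vanishing at a point whose coordinates are `d`-th roots of unity
is a zero divisor modulo `powDiffIdeal`. -/
lemma exists_mul_mem_powDiffIdeal {σ : Type*} [Fintype σ] [DecidableEq σ] {l : σ} {d a : ℕ}
    (hd : 0 < d) {c : σ → ℂ} (hc : ∀ i, c i ^ d = 1) (hcl : c l = 1)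
    {f : MvPolynomial σ ℂ} (hf : f.IsHomogeneous a) (hfc : aeval c f = 0) :
    ∃ q, q * f ∈ powDiffIdeal ℂ {i | i ≠ l} l d ∧ q ∉ powDiffIdeal ℂ {i | i ≠ l} l d := by
  set I := powDiffIdeal ℂ {i | i ≠ l} l d with hI
  let h : σ → MvPolynomial σ ℂ := fun j =>
    ∑ k ∈ Finset.range d, X j ^ k * (X l * C (c j)) ^ (d - 1 - k)
  have hh (j : σ) : h j * (X j - X l * C (c j)) = X j ^ d - X l ^ d := by
    rw [geom_sum₂_mul, mul_pow, ← map_pow, hc, map_one, mul_one]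
  let q : MvPolynomial σ ℂ := ∏ j ∈ Finset.univ.erase l, h j
  have hq (j : σ) : q * (X j - X l * C (c j)) ∈ I := by
    by_cases hj : j = l
    · simp [hj, hcl]
    · rw [show q = (∏ i ∈ (Finset.univ.erase l).erase j, h i) * h j from
        (Finset.prod_erase_mul _ _ (by simp [hj])).symm, mul_assoc, hh]
      exact I.mul_mem_left _ (Ideal.subset_span ⟨j, hj, rfl⟩)
  refine ⟨q, ?_, fun hmem => ?_⟩
  · let J : Ideal (MvPolynomial σ ℂ) :=
      Submodule.comap (LinearMap.mulLeft (MvPolynomial σ ℂ) q) I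
    have hJ (r : MvPolynomial σ ℂ) : r ∈ J ↔ q * r ∈ I := Iff.rfl
    rw [← hJ, ← Ideal.Quotient.eq_zero_iff_mem]
    have key : (Ideal.Quotient.mkₐ ℂ J) =
        (Ideal.Quotient.mkₐ ℂ J).comp (aeval fun j => X l * C (c j)) := by
      ext j
      simp only [AlgHom.comp_apply, aeval_X, Ideal.Quotient.mkₐ_eq_mk]
      rw [Ideal.Quotient.eq, hJ]
      exact hq j
    have hz : aeval (fun j => C (c j) : σ → MvPolynomial σ ℂ) f = 0 := by
      have := aeval_algebraMap_apply (MvPolynomial σ ℂ) c f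
      rw [hfc, map_zero] at this
      exact this
    have := AlgHom.congr_fun key f
    rw [AlgHom.comp_apply, aeval_mul_left_of_isHomogeneous hf, hz, mul_zero, map_zero] at this
    exact this
  · have hle : I ≤ RingHom.ker (aeval c : MvPolynomial σ ℂ →ₐ[ℂ] ℂ) := by
      rw [hI, powDiffIdeal, Ideal.span_le]
      rintro _ ⟨j, -, rfl⟩
      simp [RingHom.mem_ker, hc]
    have h0 : aeval c q = 0 := hle hmem
    rw [map_prod, Finset.prod_eq_zero_iff] at h0
    obtain ⟨j, -, hj⟩ := h0
    have hcj : c j ≠ 0 := fun h0 => by simpa [h0, hd.ne'] using hc j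
    have : aeval c (h j) = d * c j ^ (d - 1) := by
      simp only [h, map_sum, map_mul, map_pow, aeval_X, hcl, one_mul, aeval_C,
        Algebra.algebraMap_self, RingHom.id_apply]
      rw [Finset.sum_congr rfl fun k hk => ?_, Finset.sum_const, Finset.card_range, nsmul_eq_mul]
      rw [← pow_add]
      congr 1
      have := Finset.mem_range.1 hk
      omega
    rw [this] at hj
    simp [hcj, hd.ne'] at hj

/-- Products of powers of `∏ X i` and `∑ X i ^ d` are nonzerodivisors modulo `powDiffIdeal`. -/
lemma mem_powDiffIdeal_of_mul_prod_psum {σ : Type*} [Fintype σ] [DecidableEq σ] {l : σ}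
    {d : ℕ} (hd : 0 < d) (u v : ℕ) {p : MvPolynomial σ ℂ}
    (hp : p * ((∏ i, X i) ^ u * psum σ ℂ d ^ v) ∈ powDiffIdeal ℂ {i | i ≠ l} l d) :
    p ∈ powDiffIdeal ℂ {i | i ≠ l} l d := by
  have hS : (({i | i ≠ l} : Finset σ) : Set σ) = {i | i ≠ l} := by ext; simp
  set I := powDiffIdeal ℂ {i | i ≠ l} l d with hI
  let π := Ideal.Quotient.mk I
  have hl : π (X l) ∈ nonZeroDivisors (MvPolynomial σ ℂ ⧸ I) := by
    rw [mem_nonZeroDivisors_iff_right]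
    intro x hx
    obtain ⟨x, rfl⟩ := Ideal.Quotient.mk_surjective x
    rw [← map_mul, Ideal.Quotient.eq_zero_iff_mem, hI, ← hS] at hx
    rw [Ideal.Quotient.eq_zero_iff_mem, hI, ← hS]
    exact mem_powDiffIdeal_of_mul_X (by simp) hd hx
  have hpow (i : σ) : π (X i) ^ d = π (X l) ^ d := by
    by_cases h : i = l
    · rw [h]
    · exact powDiffIdeal_mk_X_pow (R := ℂ) d (show i ∈ {i | i ≠ l} from h)
  have hX (i : σ) : π (X i) ∈ nonZeroDivisors (MvPolynomial σ ℂ ⧸ I) := by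
    have : π (X i) ^ d ∈ nonZeroDivisors (MvPolynomial σ ℂ ⧸ I) := by
      rw [hpow]
      exact pow_mem hl d
    rw [← Nat.succ_pred_eq_of_pos hd, pow_succ] at this
    exact (mul_mem_nonZeroDivisors.1 this).2
  have hcard : (Fintype.card σ : ℂ) ≠ 0 :=
    Nat.cast_ne_zero.2 (Fintype.card_pos_iff.2 ⟨l⟩).ne'
  have hpsum : π (psum σ ℂ d) ∈ nonZeroDivisors (MvPolynomial σ ℂ ⧸ I) := by
    have h1 : π (psum σ ℂ d) = algebraMap ℂ _ (Fintype.card σ : ℂ) * π (X l) ^ d := by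
      rw [psum, map_sum]
      simp only [map_pow, hpow]
      simp
    rw [h1]
    exact mul_mem (((isUnit_iff_ne_zero.2 hcard).map _).mem_nonZeroDivisors) (pow_mem hl d)
  have hf : π ((∏ i, X i) ^ u * psum σ ℂ d ^ v) ∈ nonZeroDivisors (MvPolynomial σ ℂ ⧸ I) := by
    rw [map_mul, map_pow, map_pow, map_prod]
    exact mul_mem (pow_mem (prod_mem fun i _ => hX i) u) (pow_mem hpsum v)
  rw [← Ideal.Quotient.eq_zero_iff_mem] at hp ⊢
  rw [map_mul] at hp
  exact (mem_nonZeroDivisors_iff_right.1 hf) _ hp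

lemma length_powDiffSeq (n d : ℕ) : (powDiffSeq n d).length = n - 1 := by
  simp [powDiffSeq]

lemma getElem_powDiffSeq {n d i : ℕ} (hi : i < (powDiffSeq n d).length) (h1 : i < n)
    (h2 : n - 1 < n) : (powDiffSeq n d)[i] = X ⟨i, h1⟩ ^ d - X ⟨n - 1, h2⟩ ^ d := by
  simp [powDiffSeq]

lemma span_take_powDiffSeq {n d i : ℕ} (h2 : n - 1 < n) (hi : i ≤ n - 1)
    (f : MvPolynomial (Fin n) ℂ) :
    Ideal.span {p | p ∈ (powDiffSeq n d ++ [f]).take i} =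
      powDiffIdeal ℂ {j : Fin n | j.1 < i} ⟨n - 1, h2⟩ d := by
  rw [powDiffIdeal, List.take_append_of_le_length (by rwa [length_powDiffSeq])]
  congr 1
  ext p
  simp only [Set.mem_ofPred_eq, List.mem_take_iff_getElem, Set.mem_image]
  constructor
  · rintro ⟨j, hj, rfl⟩
    rw [length_powDiffSeq] at hj
    exact ⟨⟨j, by omega⟩, by simp; omega, (getElem_powDiffSeq _ _ _).symm⟩
  · rintro ⟨j, hj, rfl⟩
    exact ⟨j, by rw [length_powDiffSeq]; omega, getElem_powDiffSeq _ _ _⟩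

/-- Appending `f` to `powDiffSeq` gives a regular sequence exactly when `f` is a nonzerodivisor
modulo the ideal generated by `powDiffSeq`. -/
lemma regSeq_powDiffSeq_append_iff {n d : ℕ} (h2 : n - 1 < n) (hd : 0 < d)
    (f : MvPolynomial (Fin n) ℂ) :
    RegSeq (powDiffSeq n d ++ [f]) ↔
      ∀ p, p * f ∈ powDiffIdeal ℂ {i : Fin n | i ≠ ⟨n - 1, h2⟩} ⟨n - 1, h2⟩ d →
        p ∈ powDiffIdeal ℂ {i : Fin n | i ≠ ⟨n - 1, h2⟩} ⟨n - 1, h2⟩ d := by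
  have hset : {i : Fin n | i ≠ ⟨n - 1, h2⟩} = {i : Fin n | i.1 < n - 1} := by
    ext i
    simp only [ne_eq, Fin.ext_iff, Set.mem_ofPred_eq]
    omega
  have hlen : (powDiffSeq n d ++ [f]).length = n - 1 + 1 := by simp [length_powDiffSeq]
  rw [hset]
  constructor
  · intro h p
    have := h ⟨n - 1, by omega⟩ p
    rw [span_take_powDiffSeq h2 le_rfl] at this
    simpa [List.getElem_append, length_powDiffSeq] using this
  · rintro h ⟨i, hi⟩ p
    rw [span_take_powDiffSeq h2 (by omega)]
    rcases Nat.lt_or_ge i (n - 1) with hlt | hge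
    · have hget : (powDiffSeq n d ++ [f]).get ⟨i, hi⟩ =
          X ⟨i, by omega⟩ ^ d - X ⟨n - 1, h2⟩ ^ d := by
        rw [List.get_eq_getElem, List.getElem_append_left (by rwa [length_powDiffSeq])]
        exact getElem_powDiffSeq _ _ _
      rw [hget]
      have hS : (({j | j.1 < i} : Finset (Fin n)) : Set (Fin n)) = {j | j.1 < i} := by
        ext; simp
      rw [← hS]
      exact mem_powDiffIdeal_of_mul_sub (by simp; omega) (by simp)
        (by simp [Fin.ext_iff]; omega) hd
    · obtain rfl : i = n - 1 := by omega
      simpa [List.getElem_append, length_powDiffSeq] using h p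

/-- A symmetric homogeneous polynomial vanishes at a point whose coordinates are permuted by
multiplication by a root of unity `ζ` with `ζ ^ a ≠ 1`. -/
lemma aeval_eq_zero_of_isSymmetric {σ : Type*} {f : MvPolynomial σ ℂ} {a : ℕ}
    (hf : f.IsHomogeneous a) (hs : f.IsSymmetric) {c : σ → ℂ} {ζ : ℂ} (e : Equiv.Perm σ)
    (he : ∀ i, c (e i) = ζ * c i) (hζ : ζ ^ a ≠ 1) : aeval c f = 0 := by
  have h1 : aeval (c ∘ e) f = aeval c f := by
    rw [← aeval_rename, hs e]
  have h2 : c ∘ e = fun i => ζ * c i := funext he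
  rw [h2, aeval_mul_left_of_isHomogeneous hf] at h1
  by_contra h0
  exact hζ (mul_right_cancel₀ h0 (h1.trans (one_mul _).symm))

lemma not_goodTriple {n d a : ℕ} (hn : 2 ≤ n) (hd : 0 < d) (h : ¬ Nat.gcd d n ∣ a) :
    ¬ GoodTriple n d a := by
  rintro ⟨f, hf, hs, hreg⟩
  obtain ⟨m, rfl⟩ : ∃ m, n = m + 1 := ⟨n - 1, by omega⟩
  have hg : Nat.gcd d (m + 1) ≠ 0 := (Nat.gcd_pos_of_pos_left _ hd).ne'
  set g := Nat.gcd d (m + 1) with hgdef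
  have hprim := Complex.isPrimitiveRoot_exp g hg
  set ζ := Complex.exp (2 * Real.pi * Complex.I / g)
  have hζn : ζ ^ (m + 1) = 1 := hprim.pow_eq_one_iff_dvd _ |>.2 (Nat.gcd_dvd_right _ _)
  have hζd : ζ ^ d = 1 := hprim.pow_eq_one_iff_dvd _ |>.2 (Nat.gcd_dvd_left _ _)
  have hζa : ζ ^ a ≠ 1 := fun h' => h ((hprim.pow_eq_one_iff_dvd _).1 h')
  let c : Fin (m + 1) → ℂ := fun i => ζ ^ (i.1 + 1)
  have hfc : aeval c f = 0 := by
    refine aeval_eq_zero_of_isSymmetric hf hs (finRotate (m + 1)) (fun i => ?_) hζa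
    simp only [c, coe_finRotate]
    split_ifs with hi
    · simp [hi, hζn]
    · rw [pow_succ' ζ (i.1 + 1)]
  obtain ⟨q, hq, hq'⟩ := exists_mul_mem_powDiffIdeal (l := ⟨m + 1 - 1, by omega⟩) (c := c) hd
    (fun i => by rw [← pow_mul, mul_comm, pow_mul, hζd, one_pow]) hζn hf hfc
  exact hq' ((regSeq_powDiffSeq_append_iff (by omega) hd f).1 hreg q hq)

lemma exists_eq_mul_add_mul {n d a : ℕ} (hd : 0 < d)
    (hbig : (n - Nat.gcd d n) * (d - Nat.gcd d n) / Nat.gcd d n ≤ a) (h : Nat.gcd d n ∣ a) :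
    ∃ u v : ℕ, u * n + v * d = a := by
  have hg : 0 < Nat.gcd d n := Nat.gcd_pos_of_pos_left _ hd
  obtain ⟨d', n', hcop, hd', hn'⟩ := Nat.exists_coprime d n
  set g := Nat.gcd d n
  obtain ⟨a', rfl⟩ := h
  have e1 : n - g = (n' - 1) * g := by rw [Nat.sub_mul, one_mul, ← hn']
  have e2 : d - g = (d' - 1) * g := by rw [Nat.sub_mul, one_mul, ← hd']
  rw [e1, e2, ← mul_assoc, Nat.mul_div_cancel _ hg] at hbig
  have hle : n'.pred * d'.pred ≤ a' := by
    refine le_of_mul_le_mul_left ?_ hg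
    rw [Nat.pred_eq_sub_one, Nat.pred_eq_sub_one]
    linarith [hbig, mul_right_comm (n' - 1) g (d' - 1), mul_comm ((n' - 1) * (d' - 1)) g]
  obtain ⟨u, v, huv⟩ := Nat.exists_add_mul_eq_of_gcd_dvd_of_mul_pred_le n' d' a'
    (by rw [hcop.symm.gcd_eq_one]; exact one_dvd _) hle
  refine ⟨u, v, ?_⟩
  rw [hn', hd', ← huv]
  ring

lemma goodTriple_mul_add_mul {n d : ℕ} (hn : 2 ≤ n) (hd : 0 < d) (u v : ℕ) :
    GoodTriple n d (u * n + v * d) := by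
  refine ⟨(∏ i, X i) ^ u * psum (Fin n) ℂ d ^ v, ?_, ?_, ?_⟩
  · rw [mul_comm u, mul_comm v]
    refine (IsHomogeneous.pow ?_ u).mul (IsHomogeneous.pow ?_ v)
    · simpa using IsHomogeneous.prod Finset.univ (fun i : Fin n => (X i : MvPolynomial _ ℂ))
        (fun _ => 1) fun i _ => isHomogeneous_X ℂ i
    · exact IsHomogeneous.sum _ _ _ fun i _ => isHomogeneous_X_pow i d
  · intro e
    have h1 : rename e (∏ i, X i : MvPolynomial (Fin n) ℂ) = ∏ i, X i := by
      rw [map_prod]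
      simp only [rename_X]
      exact Equiv.prod_comp e fun i => (X i : MvPolynomial (Fin n) ℂ)
    rw [map_mul, map_pow, map_pow, h1, psum_isSymmetric _ _ _ e]
  · exact (regSeq_powDiffSeq_append_iff (by omega) hd _).2 fun p =>
      mem_powDiffIdeal_of_mul_prod_psum hd u v

theorem a_bigger_than (n d a : ℕ) (hn : 2 ≤ n) (hd : 0 < d) (ha : 0 < a)
    (hbig : (n - Nat.gcd d n) * (d - Nat.gcd d n) / Nat.gcd d n ≤ a) :
    (¬ GoodTriple n d a) ↔ ¬ Nat.gcd d n ∣ a := by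
  refine ⟨fun hbad hdvd => hbad ?_, not_goodTriple hn hd⟩
  obtain ⟨u, v, rfl⟩ := exists_eq_mul_add_mul hd hbig hdvd
  exact goodTriple_mul_add_mul hn hd u v
end

section
/- Let n ≥ 2 and let d, a be positive integers. Suppose at least two distinct primes divide d, and that n < p + q, where p < q are the two smallest distinct primes dividing d. Set g = gcd(d,n). Then the triple (n,d,a) is bad if and only if g does not divide a. -/
open MvPolynomial

/-- An element lies in the ideal generated by the `X i ^ d - X l ^ d` with `i ∈ A` exactly when it
vanishes after each substitution `X i ↦ ξ i * X l`, `i ∈ A`, by `d`-th roots of unity `ξ i`. -/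
theorem mem_span_pow_sub_pow_iff {σ : Type*} [Finite σ] {d : ℕ} (hd : 0 < d) (A : Set σ)
    [DecidablePred (· ∈ A)] {l : σ} (hl : l ∉ A) (h : MvPolynomial σ ℂ) :
    h ∈ Ideal.span ((fun i => (X i ^ d - X l ^ d : MvPolynomial σ ℂ)) '' A) ↔
      ∀ ξ : σ → ℂ, (∀ i, ξ i ^ d = 1) →
        aeval (fun i => if i ∈ A then C (ξ i) * X l else (X i : MvPolynomial σ ℂ)) h = 0 := by
  classical
  constructor
  · intro hh ξ hξ
    have hle : Ideal.span ((fun i => (X i ^ d - X l ^ d : MvPolynomial σ ℂ)) '' A) ≤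
        RingHom.ker (aeval (R := ℂ)
          (fun i => if i ∈ A then C (ξ i) * X l else (X i : MvPolynomial σ ℂ))) := by
      rw [Ideal.span_le]
      rintro _ ⟨i, hi, rfl⟩
      simp [RingHom.mem_ker, hi, hl, mul_pow, ← C_pow, hξ]
    exact hle hh
  · intro hv
    obtain ⟨ζ, hζ⟩ : ∃ ζ : ℂ, IsPrimitiveRoot ζ d :=
      ⟨_, Complex.isPrimitiveRoot_exp d hd.ne'⟩
    have hCζ : IsPrimitiveRoot (C ζ : MvPolynomial σ ℂ) d :=
      hζ.map_of_injective (C_injective σ ℂ)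
    have : NeZero d := ⟨hd.ne'⟩
    let S : σ → Finset (MvPolynomial σ ℂ) := fun i =>
      if i ∈ A then (Polynomial.nthRootsFinset d (1 : MvPolynomial σ ℂ)).image (· * X l)
      else {X i}
    have hS : ∀ i, (S i).Nonempty := by
      intro i
      by_cases hi : i ∈ A
      · simp only [S, hi, if_true, Finset.image_nonempty]
        exact ⟨1, by simp [Polynomial.mem_nthRootsFinset hd]⟩
      · simp [S, hi]
    have hprod : ∀ i ∈ A, ∏ s ∈ S i, (X i - s) = (X i ^ d - X l ^ d : MvPolynomial σ ℂ) := by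
      intro i hi
      simp only [S, hi, if_true]
      rw [Finset.prod_image, hCζ.pow_sub_pow_eq_prod_sub_mul _ _ hd]
      intro x _ y _ hxy
      exact mul_right_cancel₀ (X_ne_zero l) hxy
    obtain ⟨c, -, hc⟩ := combinatorial_nullstellensatz_exists_linearCombination S hS
      (map (C : ℂ →+* MvPolynomial σ ℂ) h) (by
        intro x hx
        have hx' : ∀ i, ∃ w : ℂ, w ^ d = 1 ∧ (i ∈ A → x i = C w * X l) := by
          intro i
          by_cases hi : i ∈ A
          · have hxi := hx i
            simp only [S, hi, if_true, Finset.mem_image, Polynomial.mem_nthRootsFinset hd] at hxi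
            obtain ⟨w, hw, hwx⟩ := hxi
            obtain ⟨k, -, rfl⟩ := hCζ.eq_pow_of_pow_eq_one hw
            refine ⟨ζ ^ k, ?_, fun _ => ?_⟩
            · rw [← pow_mul, mul_comm, pow_mul, hζ.pow_eq_one, one_pow]
            · rw [← hwx, C_pow]
          · exact ⟨1, one_pow _, fun h => absurd h hi⟩
        choose ξ hξ hξx using hx'
        have hxe : x = fun i => if i ∈ A then C (ξ i) * X l else (X i : MvPolynomial σ ℂ) := by
          funext i
          by_cases hi : i ∈ A
          · simp [hi, hξx i hi]
          · have hxi := hx i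
            simpa [S, hi] using hxi
        rw [eval_map, hxe]
        exact hv ξ hξ)
    have hback : h = eval (fun i => (X i : MvPolynomial σ ℂ)) (map C h) := by
      rw [eval_map]
      exact (eval₂_eta h).symm
    rw [hback, hc, Finsupp.linearCombination_apply, Finsupp.sum, map_sum]
    refine Ideal.sum_mem _ fun i _ => ?_
    rw [smul_eq_mul, map_mul, map_prod]
    simp only [map_sub, eval_X, eval_C]
    by_cases hi : i ∈ A
    · rw [hprod i hi]
      exact Ideal.mul_mem_left _ _ (Ideal.subset_span ⟨i, hi, rfl⟩)
    · simp [S, hi]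

theorem aeval_algebraMap_mul_of_isHomogeneous {σ B : Type*} [Finite σ] [CommRing B] [Algebra ℂ B]
    {a : ℕ} {f : MvPolynomial σ ℂ} (hf : f.IsHomogeneous a) (ξ : σ → ℂ) (y : B) :
    aeval (fun i => algebraMap ℂ B (ξ i) * y) f = algebraMap ℂ B (eval ξ f) * y ^ a := by
  have := Fintype.ofFinite σ
  rw [aeval_def, eval₂_eq', eval_eq', map_sum, Finset.sum_mul]
  refine Finset.sum_congr rfl fun m hm => ?_
  have hdeg : ∑ i, m i = a := by
    rw [← Finsupp.degree_eq_sum, ← hf (mem_support_iff.mp hm), Finsupp.degree_eq_weight_one]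
    rfl
  simp only [mul_pow, Finset.prod_mul_distrib, Finset.prod_pow_eq_pow_sum, hdeg, map_mul, map_prod,
    map_pow, mul_assoc]

theorem eval_mul_of_isHomogeneous {σ : Type*} [Finite σ] {a : ℕ} {f : MvPolynomial σ ℂ}
    (hf : f.IsHomogeneous a) (ξ : σ → ℂ) (y : ℂ) :
    eval (fun i => ξ i * y) f = eval ξ f * y ^ a :=
  aeval_algebraMap_mul_of_isHomogeneous hf ξ y

theorem set_mem_take_powDiffSeq {n d k : ℕ} (hn : 0 < n) (hk : k ≤ n - 1) :
    {p | p ∈ (powDiffSeq n d).take k} =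
      (fun i => (X i ^ d - X ⟨n - 1, by omega⟩ ^ d : MvPolynomial (Fin n) ℂ)) ''
        {i | i.1 < k} := by
  ext p
  simp only [Set.mem_ofPred_eq, Set.mem_image, powDiffSeq, List.mem_take_iff_getElem,
    List.getElem_map, List.getElem_finRange, List.length_map, List.length_finRange]
  constructor
  · rintro ⟨i, hi, rfl⟩
    exact ⟨⟨i, by omega⟩, by simp; omega, rfl⟩
  · rintro ⟨i, hi, rfl⟩
    exact ⟨i, by omega, rfl⟩

theorem regSeq_powDiffSeq_append_iff_s18 {n d a : ℕ} (hn : 2 ≤ n) (hd : 0 < d)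
    {f : MvPolynomial (Fin n) ℂ} (hf : f.IsHomogeneous a) :
    RegSeq (powDiffSeq n d ++ [f]) ↔
      ∀ ζ : Fin n → ℂ, (∀ i, ζ i ^ d = 1) → eval ζ f ≠ 0 := by
  classical
  have hlen : (powDiffSeq n d).length = n - 1 := by simp [powDiffSeq]
  let l : Fin n := ⟨n - 1, by omega⟩
  have hsub : ∀ (ξ : Fin n → ℂ) (i : Fin n), ξ l = 1 →
      (if i.1 < n - 1 then C (ξ i) * X l else (X i : MvPolynomial (Fin n) ℂ)) =
        C (ξ i) * X l := by
    intro ξ i hξ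
    split_ifs with hi
    · rfl
    · obtain rfl : i = l := Fin.ext (by simp [l]; omega)
      simp [hξ]
  have hmem : ∀ g : MvPolynomial (Fin n) ℂ,
      g ∈ Ideal.span {p | p ∈ (powDiffSeq n d).take (n - 1)} ↔
      ∀ ξ : Fin n → ℂ, ξ l = 1 → (∀ i, ξ i ^ d = 1) →
        aeval (fun i => C (ξ i) * (X l : MvPolynomial (Fin n) ℂ)) g = 0 := by
    intro g
    rw [set_mem_take_powDiffSeq (by omega) le_rfl, mem_span_pow_sub_pow_iff hd _ (by simp)]
    constructor
    · intro h ξ hl hξ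
      have := h ξ hξ
      simp only [Set.mem_ofPred_eq] at this
      simpa only [l, hsub ξ _ hl] using this
    · intro h ξ hξ
      have h1 := h (Function.update ξ l 1) (by simp) (by
        intro i
        rcases eq_or_ne i l with rfl | hi
        · simp
        · simp [hi, hξ])
      rw [← h1]
      congr 2
      funext i
      have hs := hsub (Function.update ξ l 1) i (by simp)
      rw [← hs]
      by_cases hi : i.1 < n - 1
      · have : i ≠ l := fun h => by simp [h, l] at hi
        simp [hi, this, show (⟨n - 1, by omega⟩ : Fin n) = l from rfl]
      · simp [hi]
  have haev : ∀ ξ : Fin n → ℂ, aeval (fun i => C (ξ i) * (X l : MvPolynomial (Fin n) ℂ)) f =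
      C (eval ξ f) * X l ^ a := fun ξ => aeval_algebraMap_mul_of_isHomogeneous hf ξ _
  constructor
  · intro hreg ζ hζ hfζ
    have hζ0 : ∀ i, ζ i ≠ 0 := fun i h => by simpa [h, hd.ne'] using hζ i
    have h := hreg ⟨n - 1, by simp [hlen]⟩
    simp only [List.get_eq_getElem, List.take_append_of_le_length hlen.ge] at h
    rw [List.getElem_append_right (by omega)] at h
    simp only [hlen, Nat.sub_self, List.getElem_cons_zero] at h
    let g : MvPolynomial (Fin n) ℂ :=
      ∏ i, ∏ w ∈ (Polynomial.nthRootsFinset d (1 : ℂ)).erase (ζ i / ζ l), (X i - C w * X l)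
    have hg : ∀ ξ : Fin n → ℂ,
        aeval (fun i => C (ξ i) * (X l : MvPolynomial (Fin n) ℂ)) g =
        ∏ i, ∏ w ∈ (Polynomial.nthRootsFinset d (1 : ℂ)).erase (ζ i / ζ l),
          (C (ξ i - w * ξ l) * X l) := by
      intro ξ
      simp [g, map_prod, sub_mul, mul_assoc, algebraMap_eq]
    have hgf : g * f ∈ Ideal.span {p | p ∈ (powDiffSeq n d).take (n - 1)} := by
      rw [hmem]
      intro ξ hl hξ
      rw [map_mul, haev ξ]
      by_cases hξζ : ∀ i, ξ i = ζ i / ζ l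
      · have : eval ξ f = 0 := by
          have hξ' : ξ = fun i => ζ i * (ζ l)⁻¹ := by
            funext i; rw [hξζ, div_eq_mul_inv]
          rw [hξ', eval_mul_of_isHomogeneous hf, hfζ, zero_mul]
        simp [this]
      · push Not at hξζ
        obtain ⟨i, hi⟩ := hξζ
        rw [hg, Finset.prod_eq_zero (Finset.mem_univ i), zero_mul]
        rw [Finset.prod_eq_zero (i := ξ i)]
        · simp [hi, Polynomial.mem_nthRootsFinset hd, hξ]
        · simp [hl]
    have hgJ := (hmem g).mp (h g hgf) (fun i => ζ i / ζ l) (div_self (hζ0 l)) (fun i => by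
      simp [div_pow, hζ])
    rw [hg, Finset.prod_eq_zero_iff] at hgJ
    obtain ⟨i, -, hi⟩ := hgJ
    rw [Finset.prod_eq_zero_iff] at hi
    obtain ⟨w, hw, hw0⟩ := hi
    simp only [div_self (hζ0 l), mul_one, mul_eq_zero, X_ne_zero, or_false, C_eq_zero,
      sub_eq_zero] at hw0
    exact (Finset.mem_erase.mp hw).1 hw0.symm
  · intro hne ⟨k, hk⟩ g hg
    simp only [List.length_append, hlen, List.length_singleton] at hk
    have hk' : k ≤ (powDiffSeq n d).length := by omega
    simp only [List.get_eq_getElem, List.take_append_of_le_length hk'] at hg ⊢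
    by_cases hkn : k = n - 1
    · subst hkn
      rw [List.getElem_append_right (by omega)] at hg
      simp only [hlen, Nat.sub_self, List.getElem_cons_zero] at hg
      rw [hmem] at hg ⊢
      intro ξ hl hξ
      have := hg ξ hl hξ
      rw [map_mul, haev ξ] at this
      simpa [hne ξ hξ, X_ne_zero] using this
    · rw [List.getElem_append_left (by omega)] at hg
      rw [set_mem_take_powDiffSeq (by omega) (by omega),
        mem_span_pow_sub_pow_iff hd _ (by simp; omega)] at hg ⊢
      intro ξ hξ
      have := hg ξ hξ
      simp only [powDiffSeq, List.getElem_map, List.getElem_finRange] at this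
      rw [map_mul, mul_eq_zero] at this
      refine this.resolve_right ?_
      have hkn' : ¬ n - 1 < k := by omega
      simp only [map_sub, map_pow, aeval_X, Set.mem_ofPred_eq, Fin.val_cast, lt_irrefl, if_false,
        hkn', sub_eq_zero]
      intro hX
      have := congrArg (eval (fun i : Fin n => if i.1 = k then (1 : ℂ) else 0)) hX
      have hne : ¬ n - 1 = k := by omega
      simp [hd.ne', hne] at this

theorem sum_mul_pow_eq_zero_of_coprime {ι : Type*} {s : Finset ι} {c : ι → ℤ} {z : ι → ℂ}
    {d k : ℕ} (hd : 0 < d) (hz : ∀ i ∈ s, z i ^ d = 1) (hk : k.Coprime d)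
    (h : ∑ i ∈ s, c i * z i = 0) : ∑ i ∈ s, c i * z i ^ k = 0 := by
  have hζ := Complex.isPrimitiveRoot_exp d hd.ne'
  set ζ := Complex.exp (2 * Real.pi * Complex.I / d)
  have : NeZero d := ⟨hd.ne'⟩
  have hex : ∀ i, ∃ a : ℕ, i ∈ s → ζ ^ a = z i := by
    intro i
    by_cases hi : i ∈ s
    · obtain ⟨a, -, ha⟩ := hζ.eq_pow_of_pow_eq_one (hz i hi)
      exact ⟨a, fun _ => ha⟩
    · exact ⟨0, fun h => absurd h hi⟩
  choose a ha using hex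
  let P : Polynomial ℤ := ∑ i ∈ s, Polynomial.C (c i) * Polynomial.X ^ a i
  have hP : ∀ x : ℂ, Polynomial.aeval x P = ∑ i ∈ s, c i * x ^ a i := by
    intro x
    simp [P, map_sum]
  have hdvd : Polynomial.cyclotomic d ℤ ∣ P := by
    rw [Polynomial.cyclotomic_eq_minpoly hζ hd]
    refine minpoly.isIntegrallyClosed_dvd (hζ.isIntegral hd) ?_
    rw [hP, ← h]
    exact Finset.sum_congr rfl fun i hi => by rw [ha i hi]
  have hroot : Polynomial.aeval (ζ ^ k) (Polynomial.cyclotomic d ℤ) = 0 := by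
    have h1 := (hζ.pow_of_coprime k hk).isRoot_cyclotomic hd
    rwa [Polynomial.IsRoot.def, ← Polynomial.map_cyclotomic_int, Polynomial.eval_map] at h1
  obtain ⟨Q, hQ⟩ := hdvd
  have h0 : Polynomial.aeval (ζ ^ k) P = 0 := by rw [hQ, map_mul, hroot, zero_mul]
  rw [hP] at h0
  rw [← h0]
  exact Finset.sum_congr rfl fun i hi => by rw [← ha i hi, pow_right_comm]

theorem sum_range_pow_of_pow_eq_one {K : Type*} [Field K] [DecidableEq K] {u : K} {r : ℕ}
    (hu : u ^ r = 1) : ∑ t ∈ Finset.range r, u ^ t = if u = 1 then (r : K) else 0 := by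
  split_ifs with h
  · simp [h]
  · have := mul_geom_sum u r
    rw [hu, sub_self] at this
    exact (mul_eq_zero.mp this).resolve_left (sub_ne_zero.mpr h)

/-- Fourier inversion on the group of `r`-th roots of unity. -/
theorem sum_range_inv_pow_mul_sum {ι : Type*} {s : Finset ι} {c : ι → ℤ} {z : ι → ℂ}
    {r e : ℕ} (hz : ∀ i ∈ s, z i ^ (r * e) = 1) {ω : ℂ} (hω : ω ^ r = 1) :
    ∑ t ∈ Finset.range r, (ω⁻¹) ^ t * ∑ i ∈ s, c i * z i ^ (1 + e * t) =
      r * ∑ i ∈ s with z i ^ e = ω, c i * z i := by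
  classical
  rcases Nat.eq_zero_or_pos r with rfl | hr
  · simp
  have hω0 : ω ≠ 0 := by
    rintro rfl
    simp [hr.ne'] at hω
  simp_rw [Finset.mul_sum]
  rw [Finset.sum_comm, Finset.sum_filter]
  refine Finset.sum_congr rfl fun i hi => ?_
  have hu : (z i ^ e * ω⁻¹) ^ r = 1 := by
    rw [mul_pow, ← pow_mul, mul_comm e r, hz i hi, inv_pow, hω, inv_one, one_mul]
  calc ∑ t ∈ Finset.range r, ω⁻¹ ^ t * (c i * z i ^ (1 + e * t))
      = c i * z i * ∑ t ∈ Finset.range r, (z i ^ e * ω⁻¹) ^ t := by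
        rw [Finset.mul_sum]
        refine Finset.sum_congr rfl fun t _ => ?_
        rw [pow_add, pow_mul, mul_pow]
        ring
    _ = _ := by
        rw [sum_range_pow_of_pow_eq_one hu]
        simp only [mul_inv_eq_one₀ hω0]
        split_ifs <;> ring

theorem sum_fiber_eq_zero_of_dvd {ι : Type*} {s : Finset ι} {c : ι → ℤ} {z : ι → ℂ}
    {r e : ℕ} (hr : r.Prime) (he : 0 < e) (hre : r ∣ e) (hz : ∀ i ∈ s, z i ^ (r * e) = 1)
    (h : ∑ i ∈ s, c i * z i = 0) {ω : ℂ} (hω : ω ^ r = 1) :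
    ∑ i ∈ s with z i ^ e = ω, c i * z i = 0 := by
  have h1 := sum_range_inv_pow_mul_sum (c := c) hz hω
  rw [Finset.sum_eq_zero] at h1
  · have := hr.ne_zero
    simpa [this] using h1.symm
  · intro t _
    rw [sum_mul_pow_eq_zero_of_coprime (Nat.mul_pos hr.pos he) hz _ h, mul_zero]
    have h2 : (1 + e * t).Coprime e := by simp
    exact Nat.Coprime.mul_right (h2.coprime_dvd_right hre) h2

theorem exists_forall_sum_fiber_pow_eq {ι : Type*} {s : Finset ι} {c : ι → ℤ} {z : ι → ℂ}
    {r e : ℕ} (hr : r.Prime) (he : 0 < e) (hre : ¬ r ∣ e) (hz : ∀ i ∈ s, z i ^ (r * e) = 1)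
    (h : ∑ i ∈ s, c i * z i = 0) :
    ∃ (t : ℕ) (F : ℂ), r ∣ 1 + e * t ∧ ∀ ω : ℂ, ω ^ r = 1 →
      ∑ i ∈ s with z i ^ e = ω, c i * z i ^ (1 + e * t) = F ∧
      F = ω ^ t * ∑ i ∈ s with z i ^ e = ω, c i * z i := by
  have hcop : r.Coprime e := (Nat.Prime.coprime_iff_not_dvd hr).mpr hre
  obtain ⟨t₀, ht₀, ht₀r⟩ : ∃ t < r, r ∣ 1 + e * t := by
    have := Fact.mk hr
    have hne : (e : ZMod r) ≠ 0 := by rwa [Ne, ZMod.natCast_eq_zero_iff]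
    refine ⟨(-(e : ZMod r)⁻¹).val, ZMod.val_lt _, ?_⟩
    rw [← ZMod.natCast_eq_zero_iff]
    simp [hne]
  refine ⟨t₀, (r : ℂ)⁻¹ * ∑ i ∈ s, c i * z i ^ (1 + e * t₀), ht₀r, fun ω hω => ?_⟩
  have hω0 : ω ≠ 0 := by
    rintro rfl
    simp [hr.ne_zero] at hω
  have hr0 : (r : ℂ) ≠ 0 := by exact_mod_cast hr.ne_zero
  have h1 := sum_range_inv_pow_mul_sum (c := c) hz hω
  rw [Finset.sum_eq_single_of_mem t₀ (by simpa using ht₀)] at h1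
  · have h2 : (r : ℂ)⁻¹ * ∑ i ∈ s, c i * z i ^ (1 + e * t₀) =
        ω ^ t₀ * ∑ i ∈ s with z i ^ e = ω, c i * z i := by
      rw [inv_pow] at h1
      field_simp at h1 ⊢
      rw [h1]
    refine ⟨?_, h2⟩
    rw [h2, Finset.mul_sum]
    refine Finset.sum_congr rfl fun i hi => ?_
    rw [pow_add, pow_mul, (Finset.mem_filter.mp hi).2]
    ring
  · intro t ht htne
    rw [sum_mul_pow_eq_zero_of_coprime (Nat.mul_pos hr.pos he) hz _ h, mul_zero]
    refine Nat.Coprime.mul_right ?_ (by simp)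
    refine Nat.Coprime.symm ((Nat.Prime.coprime_iff_not_dvd hr).mpr fun hdvd => htne ?_)
    have hmod : 1 + e * t ≡ 1 + e * t₀ [MOD r] :=
      ((Nat.modEq_zero_iff_dvd).mpr hdvd).trans ((Nat.modEq_zero_iff_dvd).mpr ht₀r).symm
    have h3 : t ≡ t₀ [MOD r] :=
      Nat.ModEq.cancel_left_of_coprime hcop (Nat.ModEq.add_left_cancel' 1 hmod)
    exact Nat.ModEq.eq_of_lt_of_lt h3 (by simpa using ht) ht₀

theorem sum_fiber_eq_zero_of_sum_fiber_eq_zero {ι : Type*} {s : Finset ι} {c : ι → ℤ}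
    {z : ι → ℂ} {r e : ℕ} (hr : r.Prime) (he : 0 < e) (hz : ∀ i ∈ s, z i ^ (r * e) = 1)
    (h : ∑ i ∈ s, c i * z i = 0) {ω₀ : ℂ} (hω₀ : ω₀ ^ r = 1)
    (h₀ : ∑ i ∈ s with z i ^ e = ω₀, c i * z i = 0) {ω : ℂ} (hω : ω ^ r = 1) :
    ∑ i ∈ s with z i ^ e = ω, c i * z i = 0 := by
  by_cases hre : r ∣ e
  · exact sum_fiber_eq_zero_of_dvd hr he hre hz h hω
  · obtain ⟨t, F, -, hF⟩ := exists_forall_sum_fiber_pow_eq hr he hre hz h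
    have hF0 : F = 0 := by rw [(hF ω₀ hω₀).2, h₀, mul_zero]
    have h1 := (hF ω hω).2
    have hω0 : ω ≠ 0 := by
      rintro rfl
      simp [hr.ne_zero] at hω
    rw [hF0] at h1
    exact (mul_eq_zero.mp h1.symm).resolve_left (pow_ne_zero _ hω0)

theorem sum_coeff_eq_zero_of_card_lt {ι : Type*} {d : ℕ} (hd : 0 < d) {s : Finset ι} {c : ι → ℤ}
    {z : ι → ℂ} (hs : ∀ r : ℕ, r.Prime → r ∣ d → s.card < r) (hz : ∀ i ∈ s, z i ^ d = 1)
    (h : ∑ i ∈ s, c i * z i = 0) : ∑ i ∈ s, c i = 0 := by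
  classical
  induction d using Nat.strong_induction_on generalizing s z with
  | _ d ih =>
  rcases eq_or_ne d 1 with rfl | hd1
  · have : ∑ i ∈ s, (c i : ℂ) = 0 := by
      rw [← h]
      exact Finset.sum_congr rfl fun i hi => by rw [← pow_one (z i), hz i hi, mul_one]
    exact_mod_cast this
  have hr := Nat.minFac_prime hd1
  set r := d.minFac
  obtain ⟨e, he⟩ : r ∣ d := d.minFac_dvd
  have he0 : 0 < e := Nat.pos_of_ne_zero (by rintro rfl; omega)
  rw [he] at hz
  have hrs : s.card < r := hs r hr ⟨e, he⟩
  obtain ⟨ω₀, hω₀, hω₀s⟩ : ∃ ω₀ ∈ Polynomial.nthRootsFinset r (1 : ℂ),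
      ω₀ ∉ s.image (z · ^ e) := by
    apply Finset.exists_mem_notMem_of_card_lt_card
    rw [(Complex.isPrimitiveRoot_exp r hr.ne_zero).card_nthRootsFinset]
    exact Finset.card_image_le.trans_lt hrs
  rw [Polynomial.mem_nthRootsFinset hr.pos] at hω₀
  have h₀ : ∑ i ∈ s with z i ^ e = ω₀, c i * z i = 0 := by
    rw [Finset.filter_eq_empty_iff.mpr, Finset.sum_empty]
    intro i hi hiω
    exact hω₀s (Finset.mem_image.mpr ⟨i, hi, hiω⟩)
  rw [← Finset.sum_fiberwise_of_maps_to (t := s.image (z · ^ e))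
    (fun i hi => Finset.mem_image_of_mem _ hi)]
  refine Finset.sum_eq_zero fun ω hω => ?_
  obtain ⟨i₀, hi₀, rfl⟩ := Finset.mem_image.mp hω
  have hzi₀ : z i₀ ≠ 0 := by
    intro h0
    have := hz i₀ hi₀
    simp [h0, hr.ne_zero, he0.ne'] at this
  refine ih e ?_ he0 (z := fun i => z i / z i₀) ?_ ?_ ?_
  · rw [he]
    exact lt_mul_left he0 hr.one_lt
  · intro r' hr' hr'e
    exact (Finset.card_filter_le _ _).trans_lt (hs r' hr' (he ▸ hr'e.mul_left r))
  · intro i hi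
    rw [div_pow, (Finset.mem_filter.mp hi).2, div_self (pow_ne_zero _ hzi₀)]
  · have := sum_fiber_eq_zero_of_sum_fiber_eq_zero hr he0 hz h hω₀ h₀ (ω := z i₀ ^ e)
      (by rw [← pow_mul, mul_comm, hz i₀ hi₀])
    simp_rw [← mul_div_assoc, ← Finset.sum_div]
    rw [this, zero_div]

theorem prime_pow_succ_dvd_sum_coeff {ι : Type*} {s : Finset ι} {c : ι → ℤ} {z : ι → ℂ}
    {p t k : ℕ} (hp : p.Prime) (hz : ∀ i ∈ s, z i ^ p ^ t = 1)
    (h : ∀ j ≤ k, ∑ i ∈ s, c i * z i ^ p ^ j = 0) : (p : ℤ) ^ (k + 1) ∣ ∑ i ∈ s, c i := by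
  rcases le_or_gt t k with htk | hkt
  · have h1 := h t htk
    have : ∑ i ∈ s, (c i : ℂ) = 0 := by
      rw [← h1]
      exact Finset.sum_congr rfl fun i hi => by rw [hz i hi, mul_one]
    have h2 : ∑ i ∈ s, c i = 0 := by exact_mod_cast this
    rw [h2]
    exact dvd_zero _
  have hpos : 0 < p ^ t := pow_pos hp.pos _
  have := Fact.mk hp
  have hζ := Complex.isPrimitiveRoot_exp (p ^ t) hpos.ne'
  set ζ := Complex.exp (2 * Real.pi * Complex.I / (p ^ t : ℕ))
  have : NeZero (p ^ t) := ⟨hpos.ne'⟩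
  have hex : ∀ i, ∃ a : ℕ, i ∈ s → ζ ^ a = z i := by
    intro i
    by_cases hi : i ∈ s
    · obtain ⟨a, -, ha⟩ := hζ.eq_pow_of_pow_eq_one (hz i hi)
      exact ⟨a, fun _ => ha⟩
    · exact ⟨0, fun h => absurd h hi⟩
  choose a ha using hex
  let P : Polynomial ℤ := ∑ i ∈ s, Polynomial.C (c i) * Polynomial.X ^ a i
  have hdvd : ∏ j ∈ Finset.range (k + 1), Polynomial.cyclotomic (p ^ (t - j)) ℤ ∣ P := by
    refine Finset.prod_dvd_of_isRelPrime ?_ ?_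
    · intro i hi j hj hij
      simp only [Finset.coe_range, Set.mem_Iio] at hi hj
      have hirr : ∀ j, Irreducible (Polynomial.cyclotomic (p ^ (t - j)) ℤ) := fun j =>
        Polynomial.cyclotomic.irreducible (pow_pos hp.pos _)
      rw [Function.onFun, (hirr i).isRelPrime_iff_not_dvd]
      intro hd
      have h1 := Polynomial.eq_of_monic_of_associated (Polynomial.cyclotomic.monic _ ℤ)
        (Polynomial.cyclotomic.monic _ ℤ) ((hirr i).associated_of_dvd (hirr j) hd)
      have h2 := Nat.pow_right_injective hp.two_le (Polynomial.cyclotomic_injective h1)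
      omega
    · intro j hj
      have hj' : j ≤ k := by simpa [Nat.lt_succ_iff] using hj
      have hζj : IsPrimitiveRoot (ζ ^ p ^ j) (p ^ (t - j)) := by
        refine hζ.pow hpos ?_
        rw [← pow_add]
        congr 1
        omega
      rw [Polynomial.cyclotomic_eq_minpoly hζj (pow_pos hp.pos _)]
      refine minpoly.isIntegrallyClosed_dvd (hζj.isIntegral (pow_pos hp.pos _)) ?_
      rw [← h j hj']
      simp only [P, map_sum, map_mul, map_pow, Polynomial.aeval_X, eq_intCast, map_intCast]
      exact Finset.sum_congr rfl fun i hi => by rw [← ha i hi, pow_right_comm]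
  obtain ⟨Q, hQ⟩ := hdvd
  have hev := congrArg (Polynomial.eval 1) hQ
  rw [Polynomial.eval_mul, Polynomial.eval_prod] at hev
  have hprod : ∏ j ∈ Finset.range (k + 1),
      Polynomial.eval 1 (Polynomial.cyclotomic (p ^ (t - j)) ℤ) = (p : ℤ) ^ (k + 1) := by
    rw [Finset.prod_congr rfl (g := fun _ => (p : ℤ)), Finset.prod_const, Finset.card_range]
    intro j hj
    have hj' : j ≤ k := by simpa [Nat.lt_succ_iff] using hj
    obtain ⟨m, hm⟩ : ∃ m, t - j = m + 1 := ⟨t - j - 1, by omega⟩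
    rw [hm, Polynomial.eval_one_cyclotomic_prime_pow]
  rw [hprod] at hev
  refine ⟨Polynomial.eval 1 Q, ?_⟩
  rw [← hev]
  simp [P, Polynomial.eval_finsetSum]

/-- A short vanishing sum of `p ^ t * D`-th roots of unity splits into vanishing subsums, each
supported on a coset of the group of `p ^ t`-th roots of unity, unless it has exactly `r` terms for
a prime `r ∣ D`. -/
theorem card_prime_or_sum_fiber_eq_zero {ι : Type*} {p q t D : ℕ} (hp : p.Prime) (hq : q.Prime)
    (hpq : p < q) (hD : 0 < D) (hDq : ∀ r : ℕ, r.Prime → r ∣ D → q ≤ r) {s : Finset ι} {z : ι → ℂ}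
    (hs : s.card < p + q) (hz : ∀ i ∈ s, z i ^ (p ^ t * D) = 1) (h : ∑ i ∈ s, z i = 0) :
    (s.card.Prime ∧ s.card ∣ D) ∨ ∀ η : ℂ, ∑ i ∈ s with z i ^ p ^ t = η, z i = 0 := by
  classical
  induction D using Nat.strong_induction_on generalizing s z with
  | _ D ih =>
  have hpt : 0 < p ^ t := pow_pos hp.pos _
  rcases eq_or_ne D 1 with rfl | hD1
  · refine Or.inr fun η => ?_
    rw [mul_one] at hz
    by_cases hη : η = 1
    · rwa [Finset.filter_true_of_mem fun i hi => by rw [hz i hi, hη]]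
    · rw [Finset.filter_false_of_mem fun i hi => by rw [hz i hi]; exact fun h => hη h.symm,
        Finset.sum_empty]
  obtain ⟨r, hr, hrD, hrq⟩ : ∃ r : ℕ, r.Prime ∧ r ∣ D ∧
      (r = q → ∀ r' : ℕ, r'.Prime → r' ∣ D → r' = q) := by
    by_cases hex : ∃ r : ℕ, r.Prime ∧ r ∣ D ∧ r ≠ q
    · obtain ⟨r, hr, hrD, hne⟩ := hex
      exact ⟨r, hr, hrD, fun h => absurd h hne⟩
    · push Not at hex
      exact ⟨D.minFac, Nat.minFac_prime hD1, D.minFac_dvd, fun _ => hex⟩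
  have hqr : q ≤ r := hDq r hr hrD
  obtain ⟨E, rfl⟩ := hrD
  have hE : 0 < E := Nat.pos_of_ne_zero (by rintro rfl; simp at hD)
  set e := p ^ t * E with he_def
  have he : 0 < e := Nat.mul_pos hpt hE
  have hz' : ∀ i ∈ s, z i ^ (r * e) = 1 := fun i hi => by
    rw [← hz i hi, he_def]
    congr 1
    ring
  have hz0 : ∀ i ∈ s, z i ≠ 0 := fun i hi h0 => by
    simpa [h0, hr.ne_zero, he.ne'] using hz' i hi
  have h1 : ∑ i ∈ s, ((1 : ℤ) : ℂ) * z i = 0 := by simpa using h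
  have hge : ∀ r' : ℕ, r'.Prime → r' ∣ p ^ t * (r * E) → p ≤ r' := by
    intro r' hr' hd
    rcases hr'.dvd_mul.mp hd with hd | hd
    · exact ((Nat.prime_dvd_prime_iff_eq hr' hp).mp (hr'.dvd_of_dvd_pow hd)).ge
    · exact hpq.le.trans (hDq r' hr' hd)
  by_cases hall : ∀ ω : ℂ, ω ^ r = 1 → ∑ i ∈ s with z i ^ e = ω, z i = 0
  · by_contra! hcon
    obtain ⟨hcard, η, hη⟩ := hcon
    obtain ⟨i₀, hi₀, -⟩ := Finset.exists_ne_zero_of_sum_ne_zero hη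
    rw [Finset.mem_filter] at hi₀
    obtain ⟨hi₀, rfl⟩ := hi₀
    have hzi₀ := hz0 i₀ hi₀
    set T := s.filter (fun i => z i ^ e = z i₀ ^ e) with hT
    have hTs : T ⊆ s := Finset.filter_subset _ _
    have hTsum : ∑ i ∈ T, z i = 0 := hall _ (by rw [← pow_mul, mul_comm, hz' i₀ hi₀])
    rcases ih E (lt_mul_left hE hr.one_lt) hE (fun r' hr' hd => hDq r' hr' (hd.mul_left r))
      (s := T) (z := fun i => z i / z i₀) ((Finset.card_le_card hTs).trans_lt hs)
      (fun i hi => by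
        rw [div_pow, (Finset.mem_filter.mp hi).2, div_self (pow_ne_zero _ hzi₀)])
      (by rw [← Finset.sum_div, hTsum, zero_div]) with ⟨hTp, hTE⟩ | hfib
    · have hqT : q ≤ T.card := hDq _ hTp (hTE.mul_left r)
      have hsdiff : (s \ T).card < p := by
        have := hp.pos
        rw [Finset.card_sdiff_of_subset hTs]
        omega
      have hrest : ∑ i ∈ s \ T, ((1 : ℤ) : ℂ) * z i = 0 := by
        have := Finset.sum_sdiff (f := z) hTs
        rw [hTsum, h, add_zero] at this
        simpa using this
      have hzero := sum_coeff_eq_zero_of_card_lt (Nat.mul_pos hpt hD) (c := fun _ => 1)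
        (fun r' hr' hd => hsdiff.trans_le (hge r' hr' hd))
        (fun i hi => hz i (Finset.mem_sdiff.mp hi).1) hrest
      have hempty : s \ T = ∅ := by simpa using hzero
      have hsT : s = T := (Finset.sdiff_eq_empty_iff_subset.mp hempty).antisymm hTs
      rw [hsT] at hcard
      exact hcard hTp (hTE.mul_left r)
    · apply hη
      have h2 := hfib 1
      rw [← Finset.sum_div, div_eq_zero_iff, or_iff_left hzi₀] at h2
      rw [← h2]
      refine Finset.sum_congr ?_ fun _ _ => rfl
      ext i
      simp only [hT, Finset.mem_filter, div_pow, div_eq_one_iff_eq (pow_ne_zero _ hzi₀), and_assoc,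
        and_congr_right_iff]
      refine fun _ => ⟨fun hi => ⟨?_, hi⟩, fun hi => hi.2⟩
      rw [he_def, pow_mul, hi, ← pow_mul]
  · push Not at hall
    obtain ⟨ω₁, hω₁, hne⟩ := hall
    left
    have hfib : ∀ ω : ℂ, ω ^ r = 1 → 1 ≤ (s.filter (z · ^ e = ω)).card := by
      intro ω hω
      rw [Nat.one_le_iff_ne_zero]
      intro h0
      apply hne
      rw [Finset.card_eq_zero] at h0
      have := sum_fiber_eq_zero_of_sum_fiber_eq_zero (c := fun _ => 1) hr he hz' h1 hω
        (by rw [h0, Finset.sum_empty]) hω₁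
      simpa using this
    have hre : ¬ r ∣ e := by
      intro hre
      apply hne
      have := sum_fiber_eq_zero_of_dvd (c := fun _ => 1) hr he hre hz' h1 hω₁
      simpa using this
    obtain ⟨m, F, hm, hF⟩ := exists_forall_sum_fiber_pow_eq (c := fun _ => 1) hr he hre hz' h1
    let M := Polynomial.nthRootsFinset r (1 : ℂ)
    have hMmem : ∀ ω, ω ∈ M ↔ ω ^ r = 1 := fun ω => Polynomial.mem_nthRootsFinset hr.pos _
    have hMcard : M.card = r := (Complex.isPrimitiveRoot_exp r hr.ne_zero).card_nthRootsFinset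
    have hcard : s.card = ∑ ω ∈ M, (s.filter (z · ^ e = ω)).card :=
      Finset.card_eq_sum_card_fiberwise fun i hi => by
        have : (z i ^ e) ^ r = 1 := by rw [← pow_mul, mul_comm, hz' i hi]
        exact (hMmem _).mpr this
    obtain ⟨ω₀, hω₀, hω₀1⟩ : ∃ ω₀ ∈ M, (s.filter (z · ^ e = ω₀)).card = 1 := by
      by_contra! hcon
      have : M.card • 2 ≤ ∑ ω ∈ M, (s.filter (z · ^ e = ω)).card :=
        Finset.card_nsmul_le_sum _ _ _ fun ω hω => by
          have := hfib ω ((hMmem ω).mp hω)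
          have := hcon ω hω
          omega
      rw [← hcard, hMcard, smul_eq_mul] at this
      omega
    have hone : ∀ ω ∈ M, (s.filter (z · ^ e = ω)).card = 1 := by
      intro ω hω
      rcases eq_or_ne ω ω₀ with rfl | hωne
      · exact hω₀1
      have hωr := (hMmem ω).mp hω
      have hω₀r := (hMmem ω₀).mp hω₀
      have hbound : (s.filter (z · ^ e = ω)).card + (r - 1) ≤ s.card := by
        rw [hcard, ← Finset.add_sum_erase _ _ hω]
        refine Nat.add_le_add_left ?_ _
        have := Finset.card_nsmul_le_sum (M.erase ω) (fun ω => (s.filter (z · ^ e = ω)).card) 1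
          fun ω' hω' => hfib ω' ((hMmem ω').mp (Finset.mem_of_mem_erase hω'))
        rwa [Finset.card_erase_of_mem hω, hMcard, smul_eq_mul, mul_one] at this
      have hpos := hfib ω hωr
      set T := s.filter (z · ^ e = ω) with hT
      set T₀ := s.filter (z · ^ e = ω₀) with hT₀
      have hdisj : Disjoint T T₀ := by
        rw [Finset.disjoint_left]
        intro i hi hi'
        exact hωne ((Finset.mem_filter.mp hi).2.symm.trans (Finset.mem_filter.mp hi').2)
      let c : ι → ℤ := fun i => if i ∈ T then 1 else -1
      have hcT : ∀ i ∈ T, c i = 1 := fun i hi => by simp [c, hi]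
      have hcT₀ : ∀ i ∈ T₀, c i = -1 := fun i hi => by
        simp [c, Finset.disjoint_right.mp hdisj hi]
      have hcsum : ∑ i ∈ T ∪ T₀, c i = T.card - 1 := by
        rw [Finset.sum_union hdisj, Finset.sum_congr rfl hcT, Finset.sum_congr rfl hcT₀]
        simp [hω₀1, sub_eq_add_neg]
      have hUsum : ∑ i ∈ T ∪ T₀, c i * z i ^ (1 + e * m) = 0 := by
        have hT_sum : ∑ i ∈ T, c i * z i ^ (1 + e * m) = F := by
          rw [← (hF ω hωr).1]
          exact Finset.sum_congr rfl fun i hi => by rw [hcT i hi]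
        have hT₀_sum : ∑ i ∈ T₀, c i * z i ^ (1 + e * m) = -F := by
          rw [← (hF ω₀ hω₀r).1, ← Finset.sum_neg_distrib]
          exact Finset.sum_congr rfl fun i hi => by simp [hcT₀ i hi]
        rw [Finset.sum_union hdisj, hT_sum, hT₀_sum, add_neg_cancel]
      have hUz : ∀ i ∈ T ∪ T₀, (z i ^ (1 + e * m)) ^ e = 1 := by
        intro i hi
        have his : i ∈ s := by
          rcases Finset.mem_union.mp hi with hi | hi
          exacts [(Finset.mem_filter.mp hi).1, (Finset.mem_filter.mp hi).1]
        obtain ⟨u, hu⟩ := hm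
        rw [hu, ← pow_mul, mul_right_comm, pow_mul, hz' i his, one_pow]
      rcases hqr.eq_or_lt with rfl | hqr'
      · have hE1 : E = 1 := by
          by_contra hE1
          have hmf := Nat.minFac_prime hE1
          have := hrq rfl _ hmf (E.minFac_dvd.mul_left _)
          apply hre
          rw [he_def, ← this]
          exact E.minFac_dvd.mul_left _
        rw [hE1, mul_one] at he_def
        have hdvd := prime_pow_succ_dvd_sum_coeff (c := c) (k := 0) hp
          (s := T ∪ T₀) (z := fun i => z i ^ (1 + e * m)) (t := t)
          (fun i hi => by rw [← he_def]; exact hUz i hi) (fun j hj => by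
            obtain rfl : j = 0 := by omega
            simpa using hUsum)
        rw [hcsum, zero_add, pow_one] at hdvd
        have hlt : (T.card : ℤ) - 1 < p := by omega
        have := Int.eq_zero_of_dvd_of_nonneg_of_lt (by omega) hlt hdvd
        omega
      · have hr2 : q + 2 ≤ r := by
          have hqo := hq.eq_two_or_odd
          have hro := hr.eq_two_or_odd
          have := hp.two_le
          omega
        have hUcard : (T ∪ T₀).card < p := by
          rw [Finset.card_union_of_disjoint hdisj, hω₀1]
          omega
        have := sum_coeff_eq_zero_of_card_lt he (c := c) (s := T ∪ T₀)
          (z := fun i => z i ^ (1 + e * m)) (fun r' hr' hd => hUcard.trans_le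
            (hge r' hr' (hd.trans (Nat.mul_dvd_mul_left _ (dvd_mul_left _ _))))) hUz hUsum
        omega
    rw [Finset.sum_congr rfl hone, Finset.sum_const, hMcard, smul_eq_mul, mul_one] at hcard
    rw [hcard]
    exact ⟨hr, dvd_mul_right _ _⟩

theorem exists_sum_pow_prime_pow_ne_zero {ι : Type*} [Fintype ι] [Nonempty ι] {p q d : ℕ}
    (hp : p.Prime) (hq : q.Prime) (hpq : p < q) (hd : 0 < d)
    (hsmallest : ∀ r : ℕ, r.Prime → r ∣ d → r = p ∨ q ≤ r) (hcard : Fintype.card ι < p + q)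
    (hnp : ¬ ((Fintype.card ι).Prime ∧ Fintype.card ι ∣ d)) {z : ι → ℂ} (hz : ∀ i, z i ^ d = 1) :
    ∃ j : ℕ, p ^ j ∣ d.gcd (Fintype.card ι) ∧ ∑ i, z i ^ p ^ j ≠ 0 := by
  classical
  by_contra! hcon
  obtain ⟨t, D, hpD, rfl⟩ := Nat.exists_eq_pow_mul_and_not_dvd hd.ne' p hp.ne_one
  have hD : 0 < D := Nat.pos_of_ne_zero (by rintro rfl; simp at hd)
  have hg : 0 < (p ^ t * D).gcd (Fintype.card ι) := Nat.gcd_pos_of_pos_left _ hd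
  obtain ⟨k, G, hpG, hkG⟩ := Nat.exists_eq_pow_mul_and_not_dvd hg.ne' p hp.ne_one
  have hpow : ∀ j ≤ k, ∑ i, z i ^ p ^ j = 0 := fun j hj =>
    hcon j (hkG ▸ (pow_dvd_pow p hj).mul_right G)
  have hDq : ∀ r : ℕ, r.Prime → r ∣ D → q ≤ r := by
    intro r hr hrD
    rcases hsmallest r hr (hrD.mul_left _) with rfl | h
    exacts [absurd hrD hpD, h]
  have hz0 : ∀ i, z i ≠ 0 := fun i h0 => by simpa [h0, hd.ne'] using hz i
  have hfib : ∀ i₀, ∀ j ≤ k, ∑ i with z i ^ p ^ t = z i₀ ^ p ^ t, (z i / z i₀) ^ p ^ j = 0 := by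
    intro i₀ j hj
    rcases card_prime_or_sum_fiber_eq_zero (t := t) hp hq hpq hD hDq (s := Finset.univ)
      (z := fun i => z i ^ p ^ j) hcard
      (fun i _ => by rw [pow_right_comm, hz, one_pow]) (hpow j hj) with h | h
    · exact absurd ⟨h.1, h.2.mul_left _⟩ hnp
    · have h1 := h ((z i₀ ^ p ^ j) ^ p ^ t)
      simp_rw [div_pow, ← Finset.sum_div]
      rw [div_eq_zero_iff]
      left
      rw [← h1]
      refine Finset.sum_congr ?_ fun _ _ => rfl
      ext i
      simp only [Finset.mem_filter, Finset.mem_univ, true_and]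
      rw [pow_right_comm (z i), pow_right_comm (z i₀)]
      refine ⟨fun h => by rw [h], fun h => ?_⟩
      have hne : z i₀ ^ p ^ t ≠ 0 := pow_ne_zero _ (hz0 i₀)
      rw [← div_eq_one_iff_eq hne]
      rw [← div_eq_one_iff_eq (pow_ne_zero _ hne), ← div_pow] at h
      have hcop : (p ^ j).Coprime D :=
        Nat.Coprime.pow_left _ ((Nat.Prime.coprime_iff_not_dvd hp).mpr hpD)
      have h2 : (z i ^ p ^ t / z i₀ ^ p ^ t) ^ D = 1 := by
        rw [div_pow, ← pow_mul, ← pow_mul, hz, hz, div_one]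
      have h3 := orderOf_dvd_of_pow_eq_one h
      have h4 := orderOf_dvd_of_pow_eq_one h2
      have h5 := Nat.dvd_gcd h3 h4
      rw [hcop.gcd_eq_one, Nat.dvd_one] at h5
      exact orderOf_eq_one_iff.mp h5
  have hfz : ∀ i₀, ∀ i ∈ Finset.univ.filter (fun i => z i ^ p ^ t = z i₀ ^ p ^ t),
      (z i / z i₀) ^ p ^ t = 1 := by
    intro i₀ i hi
    rw [div_pow, (Finset.mem_filter.mp hi).2, div_self (pow_ne_zero _ (hz0 i₀))]
  rcases le_or_gt t k with htk | hkt
  · obtain ⟨i₀⟩ := ‹Nonempty ι›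
    have h1 := hfib i₀ t htk
    rw [Finset.sum_congr rfl (hfz i₀)] at h1
    have h2 : i₀ ∈ Finset.univ.filter (fun i => z i ^ p ^ t = z i₀ ^ p ^ t) := by simp
    simp only [Finset.sum_const, nsmul_eq_mul, mul_one, Nat.cast_eq_zero,
      Finset.card_eq_zero] at h1
    rw [h1] at h2
    simp at h2
  · have hdvd : p ^ (k + 1) ∣ Fintype.card ι := by
      rw [← Finset.card_univ, Finset.card_eq_sum_card_fiberwise (f := fun i => z i ^ p ^ t)
        (t := Finset.univ.image fun i => z i ^ p ^ t)
        (fun i _ => Finset.mem_coe.mpr (Finset.mem_image_of_mem _ (Finset.mem_univ i)))]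
      refine Finset.dvd_sum fun η hη => ?_
      obtain ⟨i₀, -, rfl⟩ := Finset.mem_image.mp hη
      have := prime_pow_succ_dvd_sum_coeff (c := fun _ => 1) (k := k) hp (hfz i₀)
        (fun j hj => by simpa using hfib i₀ j hj)
      simp only [Finset.sum_const, nsmul_eq_mul, mul_one] at this
      exact_mod_cast this
    have h1 : p ^ (k + 1) ∣ p ^ k * G := hkG ▸
      Nat.dvd_gcd ((pow_dvd_pow p hkt).mul_right D) hdvd
    rw [pow_succ] at h1
    exact hpG (Nat.dvd_of_mul_dvd_mul_left (pow_pos hp.pos k) h1)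

theorem gcd_dvd_of_goodTriple {n d a : ℕ} (hn : 2 ≤ n) (hd : 0 < d) (h : GoodTriple n d a) :
    d.gcd n ∣ a := by
  obtain ⟨f, hf, hsymm, hreg⟩ := h
  rw [regSeq_powDiffSeq_append_iff_s18 hn hd hf] at hreg
  obtain ⟨m, rfl⟩ : ∃ m, n = m + 1 := ⟨n - 1, by omega⟩
  set g := d.gcd (m + 1)
  have hg : 0 < g := Nat.gcd_pos_of_pos_left _ hd
  have hω := Complex.isPrimitiveRoot_exp g hg.ne'
  set ω := Complex.exp (2 * Real.pi * Complex.I / g)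
  let ζ : Fin (m + 1) → ℂ := fun i => ω ^ i.1
  have hne := hreg ζ fun i => by
    rw [← pow_mul, mul_comm, pow_mul, (hω.pow_eq_one_iff_dvd d).mpr (Nat.gcd_dvd_left _ _), one_pow]
  have hshift : ζ ∘ finRotate (m + 1) = fun i => ζ i * ω := by
    funext i
    rcases eq_or_ne i (Fin.last m) with rfl | hi
    · have : ω ^ (m + 1) = 1 := (hω.pow_eq_one_iff_dvd _).mpr (Nat.gcd_dvd_right _ _)
      simp [ζ, ← pow_succ, this]
    · simp only [Function.comp, ζ, coe_finRotate_of_ne_last hi, pow_succ]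
  have h1 : eval (ζ ∘ finRotate (m + 1)) f = eval ζ f := by
    rw [← eval_rename, hsymm]
  rw [hshift, eval_mul_of_isHomogeneous hf] at h1
  exact (hω.pow_eq_one_iff_dvd a).mp (mul_left_cancel₀ hne (by rw [h1, mul_one]))

theorem goodTriple_of_forall_exists {n d a : ℕ} (hn : 2 ≤ n) (hd : 0 < d)
    (h : ∀ ζ : Fin n → ℂ, (∀ i, ζ i ^ d = 1) →
      ∃ f : MvPolynomial (Fin n) ℂ, f.IsHomogeneous a ∧ f.IsSymmetric ∧ eval ζ f ≠ 0) :
    GoodTriple n d a := by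
  let M := Polynomial.nthRootsFinset d (1 : ℂ)
  have hM : ∀ w, w ∈ M ↔ w ^ d = 1 := fun w => Polynomial.mem_nthRootsFinset hd _
  obtain ⟨f, hf, hne⟩ := Module.Dual.exists_forall_mem_ne_zero_of_forall_exists
    (homogeneousSubmodule (Fin n) ℂ a ⊓ Subalgebra.toSubmodule (symmetricSubalgebra (Fin n) ℂ))
    (fun ζ : Fin n → M => (aeval (R := ℂ) (fun i => (ζ i : ℂ))).toLinearMap) (fun ζ => by
      obtain ⟨f, hf, hsymm, hne⟩ := h (fun i => ζ i) fun i => (hM _).mp (ζ i).2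
      exact ⟨f, ⟨hf, hsymm⟩, hne⟩)
  refine ⟨f, hf.1, hf.2, (regSeq_powDiffSeq_append_iff_s18 hn hd hf.1).mpr fun ζ hζ => ?_⟩
  exact hne fun i => ⟨ζ i, (hM _).mpr (hζ i)⟩

theorem essentially (n d a p q : ℕ) (hn : 2 ≤ n) (hd : 0 < d) (ha : 0 < a)
    (hp : p.Prime) (hq : q.Prime) (hpd : p ∣ d) (hqd : q ∣ d) (hpq : p < q)
    (hsmallest : ∀ r : ℕ, r.Prime → r ∣ d → r = p ∨ q ≤ r)
    (hnpq : n < p + q) :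
    (¬ GoodTriple n d a) ↔ ¬ Nat.gcd d n ∣ a := by
  refine not_congr ⟨gcd_dvd_of_goodTriple hn hd, fun hga => ?_⟩
  have : NeZero n := ⟨by omega⟩
  refine goodTriple_of_forall_exists hn hd fun ζ hζ => ?_
  by_cases hnp : n.Prime ∧ n ∣ d
  · rw [Nat.gcd_eq_right hnp.2] at hga
    obtain ⟨b, rfl⟩ := hga
    refine ⟨(∏ i, X i) ^ b, ?_, fun e => ?_, ?_⟩
    · have := IsHomogeneous.prod Finset.univ (fun i : Fin n => (X i : MvPolynomial (Fin n) ℂ))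
        (fun _ => 1) fun i _ => isHomogeneous_X _ _
      simpa using this.pow b
    · simp only [map_pow, map_prod, rename_X]
      rw [Equiv.prod_comp e fun i => (X i : MvPolynomial (Fin n) ℂ)]
    · rw [map_pow, map_prod]
      refine pow_ne_zero _ (Finset.prod_ne_zero_iff.mpr fun i _ h0 => ?_)
      rw [eval_X] at h0
      simpa [h0, hd.ne'] using hζ i
  · obtain ⟨j, hj, hne⟩ := exists_sum_pow_prime_pow_ne_zero hp hq hpq hd hsmallest
      (by simpa using hnpq) (by simpa using hnp) hζ
    rw [Fintype.card_fin] at hj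
    obtain ⟨b, rfl⟩ := hj.trans hga
    refine ⟨psum (Fin n) ℂ (p ^ j) ^ b, ?_, fun e => ?_, ?_⟩
    · refine IsHomogeneous.pow (IsHomogeneous.sum _ _ _ fun i _ => ?_) b
      simpa using (isHomogeneous_X ℂ i).pow (p ^ j)
    · rw [map_pow, psum_isSymmetric]
    · rw [map_pow]
      refine pow_ne_zero _ ?_
      simpa [psum, map_sum] using hne
end
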